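/- Let x ∈ K^56 be a point at which the coordinates η'_1 = x^{18}, …, η'_7 = x^{78} are all nonzero. If the following 28 equations hold at x: v^8_i = 0 for i = 2,…,7; u^{1jk8} = 0 for 2 ≤ j < k ≤ 7; v^1_i = 0 for i = 2,…,7; and v^2_1 = 0, then x lies on H_7, i.e., all equations u^{ijkl} = 0, v^i_j = 0 (i ≠ j), and v^i_i = 0 hold at x. -/

import Mathlib

/-- Index pairs `(i,j)` with `i < j` in `{1,…,8}` (0-based `Fin 8`). -/
abbrev P8 := {p : Fin 8 × Fin 8 // p.1 < p.2}

/-- The 56 coordinates: `x^{ij}` (left) and `y_{ij}` (right) for `i < j`. -/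
abbrev I56 := P8 ⊕ P8

variable {K : Type} [Field K]

/-- The antisymmetric extension `x^{ij}` (with `x^{ji} = −x^{ij}`, `x^{ii} = 0`). -/
def xc (z : I56 → K) (i j : Fin 8) : K :=
  if h : i < j then z (Sum.inl ⟨(i, j), h⟩)
  else if h : j < i then -z (Sum.inl ⟨(j, i), h⟩) else 0

/-- The antisymmetric extension `y_{ij}` (with `y_{ji} = −y_{ij}`, `y_{ii} = 0`). -/
def yc (z : I56 → K) (i j : Fin 8) : K :=
  if h : i < j then z (Sum.inr ⟨(i, j), h⟩)
  else if h : j < i then -z (Sum.inr ⟨(j, i), h⟩) else 0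

/-- The quadric `u^{ijkl}` for `i<j<k<l` with sorted complement `a<b<c<d`; the sign
`σ` of the shuffle permutation `(i,j,k,l,a,b,c,d)` equals `(−1)^{i+j+k+l}` (0-based). -/
def uEq (z : I56 → K) (i j k l a b c d : Fin 8) : K :=
  xc z i j * xc z k l - xc z i k * xc z j l + xc z i l * xc z j k +
    (-1 : K) ^ ((i : ℕ) + (j : ℕ) + (k : ℕ) + (l : ℕ)) *
      (yc z a b * yc z c d - yc z a c * yc z b d + yc z a d * yc z b c)

/-- The quadric `v^i_j = Σ_{k ∉ {i,j}} x^{ik} y_{kj}` for `i ≠ j`. -/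
def vEq (z : I56 → K) (i j : Fin 8) : K :=
  ∑ k ∈ Finset.univ \ {i, j}, xc z i k * yc z k j

/-- The quadric `v^i_i = −(3/4) Σ_{j≠i} x^{ij}y_{ij} + (1/4) Σ_{j<k, j,k≠i} x^{jk}y_{jk}`. -/
def vDiag (z : I56 → K) (i : Fin 8) : K :=
  -((3 / 4 : K) * (∑ j ∈ Finset.univ \ {i}, xc z i j * yc z i j))
    + (1 / 4 : K) * (∑ p ∈ Finset.univ.filter
        (fun p : Fin 8 × Fin 8 => p.1 < p.2 ∧ p.1 ≠ i ∧ p.2 ≠ i),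
        xc z p.1 p.2 * yc z p.1 p.2)

/-- Membership in the affine cone `H₇` over `G₇/P₇`: all equations
`u^{ijkl} = 0`, `v^i_j = 0` (`i ≠ j`) and `v^i_i = 0` hold. -/
def H7mem (z : I56 → K) : Prop :=
  (∀ i j k l a b c d : Fin 8, i < j → j < k → k < l → a < b → b < c → c < d →
      ({i, j, k, l, a, b, c, d} : Finset (Fin 8)) = Finset.univ →
      uEq z i j k l a b c d = 0) ∧
  (∀ i j : Fin 8, i ≠ j → vEq z i j = 0) ∧
  (∀ i : Fin 8, vDiag z i = 0)

open Equiv Matrix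

/-- The Pfaffian of the `4 × 4` block of `A` with rows and columns `a, b, c, d`. -/
def pf (A : Matrix (Fin 8) (Fin 8) K) (a b c d : Fin 8) : K :=
  A a b * A c d - A a c * A b d + A a d * A b c

/-- The quadric `u^{ijkl}` for an arbitrary ordering `σ` of the indices and their complement. -/
def pluckerU (X Y : Matrix (Fin 8) (Fin 8) K) (σ : Perm (Fin 8)) : K :=
  pf X (σ 0) (σ 1) (σ 2) (σ 3) + ((Perm.sign σ : ℤ) : K) * pf Y (σ 4) (σ 5) (σ 6) (σ 7)

theorem pf_swap {A : Matrix (Fin 8) (Fin 8) K} (hA : ∀ i j, A i j = -A j i)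
    (g : Fin 4 → Fin 8) {x y : Fin 4} (hxy : x ≠ y) :
    pf A (g (swap x y 0)) (g (swap x y 1)) (g (swap x y 2)) (g (swap x y 3)) =
      -pf A (g 0) (g 1) (g 2) (g 3) := by
  have h01 := hA (g 0) (g 1)
  have h02 := hA (g 0) (g 2)
  have h03 := hA (g 0) (g 3)
  have h12 := hA (g 1) (g 2)
  have h13 := hA (g 1) (g 3)
  have h23 := hA (g 2) (g 3)
  fin_cases x <;> fin_cases y <;> simp [swap_apply_def, pf] at hxy ⊢ <;>
    simp only [h01, h02, h03, h12, h13, h23] <;> ring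

theorem pf_perm {A : Matrix (Fin 8) (Fin 8) K} (hA : ∀ i j, A i j = -A j i)
    (f : Fin 4 → Fin 8) (τ : Perm (Fin 4)) :
    pf A (f (τ 0)) (f (τ 1)) (f (τ 2)) (f (τ 3)) =
      ((Perm.sign τ : ℤ) : K) * pf A (f 0) (f 1) (f 2) (f 3) := by
  induction τ using Perm.swap_induction_on' with
  | one => simp
  | mul_swap τ x y hxy ih =>
    simpa [Perm.sign_swap hxy, ih] using pf_swap hA (f ∘ τ) hxy

set_option synthInstance.maxSize 2000 in
set_option synthInstance.maxHeartbeats 400000 in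
theorem sign_sorted : ∀ a b : Fin 8, a < b → ∀ c, b < c → ∀ d, c < d →
    ∀ e, e ≠ a ∧ e ≠ b ∧ e ≠ c ∧ e ≠ d → ∀ f, e < f ∧ f ≠ a ∧ f ≠ b ∧ f ≠ c ∧ f ≠ d →
    ∀ g, f < g ∧ g ≠ a ∧ g ≠ b ∧ g ≠ c ∧ g ≠ d → ∀ h, g < h ∧ h ≠ a ∧ h ≠ b ∧ h ≠ c ∧ h ≠ d →
    (∏ j, ∏ i ∈ Finset.Iio j, if ![a, b, c, d, e, f, g, h] i < ![a, b, c, d, e, f, g, h] j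
      then (1 : ℤ) else -1) = (-1) ^ ((a : ℕ) + b + c + d) := by
  decide +kernel

theorem mul_apply_perm (X Y : Matrix (Fin 8) (Fin 8) K) (σ : Perm (Fin 8)) (i j : Fin 8) :
    (X * Y) i j =
      X i (σ 0) * Y (σ 0) j + X i (σ 1) * Y (σ 1) j + X i (σ 2) * Y (σ 2) j +
      X i (σ 3) * Y (σ 3) j + X i (σ 4) * Y (σ 4) j + X i (σ 5) * Y (σ 5) j +
      X i (σ 6) * Y (σ 6) j + X i (σ 7) * Y (σ 7) j := by
  rw [Matrix.mul_apply, ← Equiv.sum_comp σ, Fin.sum_univ_eight]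

/-- The permutation of `Fin 8` acting by `τ₁` on the first and `τ₂` on the last four letters. -/
def blockPerm (τ₁ τ₂ : Perm (Fin 4)) : Perm (Fin 8) :=
  (finSumFinEquiv (m := 4) (n := 4)).permCongr (sumCongr τ₁ τ₂)

theorem blockPerm_castAdd (τ₁ τ₂ : Perm (Fin 4)) (i : Fin 4) :
    blockPerm τ₁ τ₂ (Fin.castAdd 4 i) = Fin.castAdd 4 (τ₁ i) := by
  rw [blockPerm, permCongr_apply, finSumFinEquiv_symm_apply_castAdd]
  rfl

theorem blockPerm_natAdd (τ₁ τ₂ : Perm (Fin 4)) (i : Fin 4) :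
    blockPerm τ₁ τ₂ (Fin.natAdd 4 i) = Fin.natAdd 4 (τ₂ i) := by
  rw [blockPerm, permCongr_apply, finSumFinEquiv_symm_apply_natAdd]
  rfl

theorem pluckerU_mul_blockPerm {X Y : Matrix (Fin 8) (Fin 8) K} (hX : ∀ i j, X i j = -X j i)
    (hY : ∀ i j, Y i j = -Y j i) (σ : Perm (Fin 8)) (τ₁ τ₂ : Perm (Fin 4)) :
    pluckerU X Y (σ * blockPerm τ₁ τ₂) = ((Perm.sign τ₁ : ℤ) : K) * pluckerU X Y σ := by
  have h1 := pf_perm hX (σ ∘ Fin.castAdd 4) τ₁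
  have h2 := pf_perm hY (σ ∘ Fin.natAdd 4) τ₂
  have hs : Perm.sign (σ * blockPerm τ₁ τ₂) = Perm.sign σ * (Perm.sign τ₁ * Perm.sign τ₂) := by
    rw [Perm.sign_mul, blockPerm, Perm.sign_permCongr, Perm.sign_sumCongr]
  have hl (i : Fin 4) : blockPerm τ₁ τ₂ (Fin.castAdd 4 i) = Fin.castAdd 4 (τ₁ i) :=
    blockPerm_castAdd τ₁ τ₂ i
  have hr (i : Fin 4) : blockPerm τ₁ τ₂ (Fin.natAdd 4 i) = Fin.natAdd 4 (τ₂ i) :=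
    blockPerm_natAdd τ₁ τ₂ i
  have e1 : pf X ((σ * blockPerm τ₁ τ₂) 0) ((σ * blockPerm τ₁ τ₂) 1) ((σ * blockPerm τ₁ τ₂) 2)
      ((σ * blockPerm τ₁ τ₂) 3) = ((Perm.sign τ₁ : ℤ) : K) * pf X (σ 0) (σ 1) (σ 2) (σ 3) := by
    refine Eq.trans ?_ h1
    simp only [Function.comp_apply, ← hl]
    rfl
  have e2 : pf Y ((σ * blockPerm τ₁ τ₂) 4) ((σ * blockPerm τ₁ τ₂) 5) ((σ * blockPerm τ₁ τ₂) 6)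
      ((σ * blockPerm τ₁ τ₂) 7) = ((Perm.sign τ₂ : ℤ) : K) * pf Y (σ 4) (σ 5) (σ 6) (σ 7) := by
    refine Eq.trans ?_ h2
    simp only [Function.comp_apply, ← hr]
    rfl
  have h4 : ((Perm.sign τ₂ : ℤ) : K) * ((Perm.sign τ₂ : ℤ) : K) = 1 := by
    rw [← Int.cast_mul, ← Units.val_mul, Int.units_mul_self, Units.val_one, Int.cast_one]
  rw [pluckerU, e1, e2, hs, pluckerU]
  push_cast
  linear_combination ((Perm.sign σ : ℤ) : K) * ((Perm.sign τ₁ : ℤ) : K) *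
    pf Y (σ 4) (σ 5) (σ 6) (σ 7) * h4

theorem pluckerU_mul_blockPerm_eq_zero {X Y : Matrix (Fin 8) (Fin 8) K}
    (hX : ∀ i j, X i j = -X j i) (hY : ∀ i j, Y i j = -Y j i) {σ : Perm (Fin 8)}
    (τ₁ τ₂ : Perm (Fin 4)) :
    pluckerU X Y (σ * blockPerm τ₁ τ₂) = 0 ↔ pluckerU X Y σ = 0 := by
  rw [pluckerU_mul_blockPerm hX hY]
  rcases Int.units_eq_one_or (Perm.sign τ₁) with h | h <;> simp [h]

theorem pluckerU_mul_swap (X Y : Matrix (Fin 8) (Fin 8) K) (σ : Perm (Fin 8)) (i j : Fin 8)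
    (hij : i ≠ j) :
    pluckerU X Y (σ * swap i j) = pf X (σ (swap i j 0)) (σ (swap i j 1)) (σ (swap i j 2))
      (σ (swap i j 3)) - ((Perm.sign σ : ℤ) : K) * pf Y (σ (swap i j 4)) (σ (swap i j 5))
      (σ (swap i j 6)) (σ (swap i j 7)) := by
  simp [pluckerU, Perm.sign_swap hij, sub_eq_add_neg]

section Propagation

variable {X Y : Matrix (Fin 8) (Fin 8) K}

theorem apply_self_of_skew [CharZero K] (hX : ∀ i j, X i j = -X j i) (i : Fin 8) : X i i = 0 :=
  self_eq_neg.mp (hX i i)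

theorem skew_mul_mul (hX : ∀ i j, X i j = -X j i) (hY : ∀ i j, Y i j = -Y j i) (i j : Fin 8) :
    (X * Y * X) i j = -(X * Y * X) j i := by
  have hX' : Xᵀ = -X := by ext i j; exact hX j i
  have hY' : Yᵀ = -Y := by ext i j; exact hY j i
  have h : (X * Y * X)ᵀ = -(X * Y * X) := by
    simp [Matrix.transpose_mul, hX', hY', Matrix.mul_assoc]
  exact congrFun (congrFun h j) i

theorem exists_perm_four {p q r t : Fin 8} (hpq : p ≠ q) (hpr : p ≠ r) (hpt : p ≠ t) (hqr : q ≠ r)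
    (hqt : q ≠ t) (hrt : r ≠ t) : ∃ σ : Perm (Fin 8), σ 0 = p ∧ σ 1 = q ∧ σ 2 = r ∧ σ 3 = t := by
  have hinj : Function.Injective ![p, q, r, t] := by
    intro i j h
    fin_cases i <;> fin_cases j <;> simp_all
  have := Equiv.Perm.isMultiplyPretransitive (Fin 8) 4
  obtain ⟨σ, hσ⟩ := MulAction.exists_smul_eq (Perm (Fin 8))
    (Fin.castLEEmb (show 4 ≤ 8 by norm_num)) ⟨_, hinj⟩
  have h (i : Fin 4) := DFunLike.congr_fun hσ i
  exact ⟨σ, h 0, h 1, h 2, h 3⟩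

theorem pluckerU_eq_zero_of_exchange [CharZero K] (hX : ∀ i j, X i j = -X j i)
    (hY : ∀ i j, Y i j = -Y j i) (hv : ∀ i, i ≠ 7 → (X * Y) 7 i = 0) (σ : Perm (Fin 8)) (h3 : σ 3 = 7)
    (hη : X (σ 4) 7 ≠ 0)
    (h04 : pluckerU X Y (σ * swap 0 4) = 0) (h14 : pluckerU X Y (σ * swap 1 4) = 0)
    (h24 : pluckerU X Y (σ * swap 2 4) = 0) : pluckerU X Y σ = 0 := by
  have hne (i : Fin 8) (hi : i ≠ 3) : σ i ≠ 7 := fun h => hi (σ.injective (h.trans h3.symm))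
  have v5 := hv (σ 5) (hne 5 (by decide))
  have v6 := hv (σ 6) (hne 6 (by decide))
  have v7 := hv (σ 7) (hne 7 (by decide))
  rw [mul_apply_perm X Y σ] at v5 v6 v7
  rw [pluckerU_mul_swap _ _ _ _ _ (by decide)] at h04 h14 h24
  simp [swap_apply_def, pf] at h04 h14 h24
  refine (mul_eq_zero_iff_left hη).mp ?_
  simp only [pluckerU, pf]
  have hX7 (i : Fin 8) := hX 7 (σ i)
  simp only [h3, hX7, hX (σ 4) (σ 1), hX (σ 4) (σ 2), hY (σ 6) (σ 5),
    hY (σ 7) (σ 5), hY (σ 7) (σ 6), apply_self_of_skew hX, apply_self_of_skew hY] at h04 h14 h24 v5 v6 v7 ⊢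
  set s := ((Perm.sign σ : ℤ) : K)
  linear_combination X (σ 0) 7 * h04 + X (σ 1) 7 * h14 + X (σ 2) 7 * h24 -
    s * (Y (σ 6) (σ 7) * v5 - Y (σ 5) (σ 7) * v6 + Y (σ 5) (σ 6) * v7)

theorem mul_apply_exchange [CharZero K] (hX : ∀ i j, X i j = -X j i) (hY : ∀ i j, Y i j = -Y j i)
    (hv : ∀ i, i ≠ 7 → (X * Y) 7 i = 0)
    (hu : ∀ σ : Perm (Fin 8), σ 3 = 7 → pluckerU X Y σ = 0)
    {p q r : Fin 8} (hpq : p ≠ q) (hpr : p ≠ r) (hqr : q ≠ r) (hp : p ≠ 7) (hq : q ≠ 7)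
    (hr : r ≠ 7) : X p 7 * (X * Y) q r = X q 7 * (X * Y) p r := by
  obtain ⟨σ, rfl, rfl, rfl, h3⟩ := exists_perm_four hpq hpr hp hqr hq hr
  have v := hv _ hr
  have h (i : Fin 8) (hi : 2 ≠ i) (hi' : i ≠ 3) := hu (σ * swap 2 i)
    (by rw [Perm.mul_apply, swap_apply_of_ne_of_ne (by decide) hi'.symm, h3])
  have h4 := h 4 (by decide) (by decide)
  have h5 := h 5 (by decide) (by decide)
  have h6 := h 6 (by decide) (by decide)
  have h7 := h 7 (by decide) (by decide)
  rw [pluckerU_mul_swap _ _ _ _ _ (by decide)] at h4 h5 h6 h7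
  simp [swap_apply_def, pf] at h4 h5 h6 h7
  rw [mul_apply_perm X Y σ] at v ⊢
  rw [mul_apply_perm X Y σ (σ 0)]
  have hX7 (i : Fin 8) := hX 7 (σ i)
  simp only [h3, hX7, hX (σ 1) (σ 0), hY (σ 4) (σ 2), hY (σ 5) (σ 2),
    hY (σ 6) (σ 2), hY (σ 7) (σ 2), apply_self_of_skew hX, apply_self_of_skew hY]
    at h4 h5 h6 h7 v ⊢
  linear_combination -Y (σ 2) (σ 4) * h4 - Y (σ 2) (σ 5) * h5 - Y (σ 2) (σ 6) * h6 -
    Y (σ 2) (σ 7) * h7 + X (σ 0) (σ 1) * v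

theorem pluckerU_eq_zero_of_last [CharZero K] (hX : ∀ i j, X i j = -X j i)
    (hY : ∀ i j, Y i j = -Y j i) (hv : ∀ i j, i ≠ j → (X * Y) i j = 0)
    (hu : ∀ σ : Perm (Fin 8), (∃ i : Fin 4, σ (Fin.castAdd 4 i) = 7) → pluckerU X Y σ = 0)
    (σ : Perm (Fin 8)) (h7 : σ 7 = 7) (hη : X (σ 0) 7 ≠ 0) : pluckerU X Y σ = 0 := by
  have v (i : Fin 8) (hi : 0 ≠ i) := hv (σ 0) (σ i) (fun h => hi (σ.injective h))
  have v4 := v 4 (by decide)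
  have v5 := v 5 (by decide)
  have v6 := v 6 (by decide)
  have h1 := hu (σ * swap 1 7) ⟨1, by simpa using h7⟩
  have h2 := hu (σ * swap 2 7) ⟨2, by simpa using h7⟩
  have h3 := hu (σ * swap 3 7) ⟨3, by simpa using h7⟩
  rw [pluckerU_mul_swap _ _ _ _ _ (by decide)] at h1 h2 h3
  simp [swap_apply_def, pf] at h1 h2 h3
  rw [mul_apply_perm X Y σ] at v4 v5 v6
  refine (mul_eq_zero_iff_left hη).mp ?_
  simp only [pluckerU, pf]
  have hX7 (i : Fin 8) := hX 7 (σ i)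
  have hY7 (i : Fin 8) := hY 7 (σ i)
  simp only [h7, hX7, hY7, hY (σ 6) (σ 5), hY (σ 6) (σ 4), hY (σ 5) (σ 4),
    hY (σ 4) (σ 1), hY (σ 4) (σ 2), hY (σ 4) (σ 3), hY (σ 5) (σ 1), hY (σ 5) (σ 2),
    hY (σ 5) (σ 3), hY (σ 6) (σ 1), hY (σ 6) (σ 2), hY (σ 6) (σ 3),
    apply_self_of_skew hX, apply_self_of_skew hY] at h1 h2 h3 v4 v5 v6 ⊢
  set s := ((Perm.sign σ : ℤ) : K)
  linear_combination X (σ 0) (σ 1) * h1 + X (σ 0) (σ 2) * h2 + X (σ 0) (σ 3) * h3 -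
    s * (Y (σ 5) (σ 6) * v4 - Y (σ 4) (σ 6) * v5 + Y (σ 4) (σ 5) * v6)

theorem mul_apply_of_first_column [CharZero K] (hX : ∀ i j, X i j = -X j i)
    (hY : ∀ i j, Y i j = -Y j i) (hη : X 0 7 ≠ 0)
    (hv : ∀ i, i ≠ 0 → i ≠ 7 → (X * Y) 7 i = 0) (i : Fin 8) (hi : i ≠ 7) : (X * Y) 7 i = 0 := by
  by_cases h0 : i = 0
  · subst h0
    have h := self_eq_neg.mp (skew_mul_mul hX hY 7 7)
    rw [Matrix.mul_apply, Finset.sum_eq_single 0] at h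
    · exact (mul_eq_zero_iff_right hη).mp h
    · intro k _ hk
      by_cases hk7 : k = 7
      · rw [hk7, apply_self_of_skew hX, mul_zero]
      · rw [hv k hk hk7, zero_mul]
    · simp
  · exact hv i h0 hi

theorem mul_eq_scalar_of_block [CharZero K] (hX : ∀ i j, X i j = -X j i)
    (hY : ∀ i j, Y i j = -Y j i) (hη : ∀ i, i ≠ 7 → X i 7 ≠ 0)
    (hrow : ∀ i, i ≠ 7 → (X * Y) 7 i = 0)
    (hblock : ∀ i j, i ≠ j → i ≠ 7 → j ≠ 7 → (X * Y) i j = 0) (i j : Fin 8) :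
    (X * Y) i j = if i = j then (X * Y) 7 7 else 0 := by
  have hskew := skew_mul_mul hX hY
  have hcol (i : Fin 8) (hi : i ≠ 7) : (X * Y) i 7 = 0 := by
    have h := self_eq_neg.mp (hskew i i)
    rw [Matrix.mul_apply, Finset.sum_eq_single 7, hX 7 i, mul_neg, neg_eq_zero] at h
    · exact (mul_eq_zero_iff_right (hη i hi)).mp h
    · intro k _ hk
      by_cases hki : i = k
      · rw [hki, apply_self_of_skew hX, mul_zero]
      · rw [hblock i k hki hi hk, zero_mul]
    · simp
  have hoff (i j : Fin 8) (hij : i ≠ j) : (X * Y) i j = 0 := by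
    by_cases hi : i = 7
    · subst hi
      exact hrow j hij.symm
    · by_cases hj : j = 7
      · subst hj
        exact hcol i hi
      · exact hblock i j hij hi hj
  split_ifs with hij
  · subst hij
    by_cases hi : i = 7
    · rw [hi]
    · have hMX (k l : Fin 8) : (X * Y * X) k l = (X * Y) k k * X k l := by
        rw [Matrix.mul_apply, Finset.sum_eq_single k]
        · intro m _ hm
          rw [hoff k m hm.symm, zero_mul]
        · simp
      have h := hskew i 7
      rw [hMX, hMX, hX 7 i, mul_neg, neg_neg] at h
      exact mul_right_cancel₀ (hη i hi) h
  · exact hoff i j hij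

theorem pluckerU_eq_zero_of_seven_mem [CharZero K] (hX : ∀ i j, X i j = -X j i)
    (hY : ∀ i j, Y i j = -Y j i) (hη : X 0 7 ≠ 0) (hrow : ∀ i, i ≠ 7 → (X * Y) 7 i = 0)
    (hu : ∀ σ : Perm (Fin 8), σ 0 = 0 → σ 3 = 7 → pluckerU X Y σ = 0) (σ : Perm (Fin 8))
    (h7 : ∃ i : Fin 4, σ (Fin.castAdd 4 i) = 7) : pluckerU X Y σ = 0 := by
  have hu' (σ : Perm (Fin 8)) (h3 : σ 3 = 7) (i : Fin 4) (hi : 3 ≠ i)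
      (h0 : σ (Fin.castAdd 4 i) = 0) : pluckerU X Y σ = 0 := by
    refine (pluckerU_mul_blockPerm_eq_zero hX hY (swap 0 i) 1).mp (hu _ ?_ ?_)
    · change σ (blockPerm _ _ (Fin.castAdd 4 0)) = 0
      rw [blockPerm_castAdd, swap_apply_left, h0]
    · change σ (blockPerm _ _ (Fin.castAdd 4 3)) = 7
      rw [blockPerm_castAdd, swap_apply_of_ne_of_ne (by decide) hi]
      exact h3
  obtain ⟨i, hi⟩ := h7
  rw [← pluckerU_mul_blockPerm_eq_zero hX hY (swap 3 i) 1]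
  set ρ := σ * blockPerm (swap 3 i) 1
  have h3 : ρ 3 = 7 := by
    change σ (blockPerm _ _ (Fin.castAdd 4 3)) = 7
    rw [blockPerm_castAdd, swap_apply_left, hi]
  clear_value ρ
  obtain ⟨m, hm⟩ := ρ.surjective 0
  induction m using Fin.addCases (m := 4) (n := 4) with
  | left m =>
    refine hu' ρ h3 m ?_ hm
    rintro rfl
    exact absurd (h3.symm.trans hm) (by decide)
  | right m =>
    rw [← pluckerU_mul_blockPerm_eq_zero hX hY 1 (swap 0 m)]
    set π := ρ * blockPerm 1 (swap 0 m)
    have hπ3 : π 3 = 7 := by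
      change ρ (blockPerm _ _ (Fin.castAdd 4 3)) = 7
      rw [blockPerm_castAdd]
      exact h3
    have hπ4 : π 4 = 0 := by
      change ρ (blockPerm _ _ (Fin.natAdd (m := 4) 4 0)) = 0
      rw [blockPerm_natAdd, swap_apply_left, hm]
    have h (i : Fin 4) (hi : 3 ≠ i) : pluckerU X Y (π * swap (Fin.castAdd 4 i) 4) = 0 := by
      refine hu' _ ?_ i hi ?_
      · rw [Perm.mul_apply, swap_apply_of_ne_of_ne _ (by decide), hπ3]
        exact fun h => hi (Fin.castAdd_injective 4 4 h)
      · rw [Perm.mul_apply, swap_apply_left, hπ4]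
    exact pluckerU_eq_zero_of_exchange hX hY hrow π hπ3 (by rwa [hπ4]) (h 0 (by decide))
      (h 1 (by decide)) (h 2 (by decide))

theorem pluckerU_eq_zero [CharZero K] (hX : ∀ i j, X i j = -X j i) (hY : ∀ i j, Y i j = -Y j i)
    (hη : ∀ i, i ≠ 7 → X i 7 ≠ 0) (hv : ∀ i j, i ≠ j → (X * Y) i j = 0)
    (hu : ∀ σ : Perm (Fin 8), σ 0 = 0 → σ 3 = 7 → pluckerU X Y σ = 0) (σ : Perm (Fin 8)) :
    pluckerU X Y σ = 0 := by
  have hu' := pluckerU_eq_zero_of_seven_mem hX hY (hη 0 (by decide))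
    (fun i hi => hv 7 i hi.symm) hu
  obtain ⟨m, hm⟩ := σ.surjective 7
  induction m using Fin.addCases (m := 4) (n := 4) with
  | left m => exact hu' σ ⟨m, hm⟩
  | right m =>
    rw [← pluckerU_mul_blockPerm_eq_zero hX hY 1 (swap 3 m)]
    set ρ := σ * blockPerm 1 (swap 3 m)
    have h7 : ρ 7 = 7 := by
      change σ (blockPerm _ _ (Fin.natAdd (m := 4) 4 3)) = 7
      rw [blockPerm_natAdd, swap_apply_left, hm]
    refine pluckerU_eq_zero_of_last hX hY hv hu' ρ h7 (hη _ fun h => ?_)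
    exact absurd (ρ.injective (h.trans h7.symm)) (by decide)

end Propagation

theorem xc_skew (z : I56 → K) (i j : Fin 8) : xc z i j = -xc z j i := by
  rcases lt_trichotomy i j with h | rfl | h <;> simp [xc, *, not_lt_of_gt]

theorem yc_skew (z : I56 → K) (i j : Fin 8) : yc z i j = -yc z j i := by
  rcases lt_trichotomy i j with h | rfl | h <;> simp [yc, *, not_lt_of_gt]

theorem vEq_eq_mul (z : I56 → K) {i j : Fin 8} (hij : i ≠ j) :
    vEq z i j = (Matrix.of (xc z) * Matrix.of (yc z)) i j := by
  rw [vEq, Matrix.mul_apply]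
  refine Finset.sum_subset (Finset.subset_univ _) fun k _ hk => ?_
  have h : k = i ∨ k = j := by simpa [or_iff_not_imp_left] using hk
  rcases h with rfl | rfl <;> simp [xc, yc]

theorem uEq_eq_pluckerU (z : I56 → K) (ρ : Perm (Fin 8)) (h01 : ρ 0 < ρ 1) (h12 : ρ 1 < ρ 2)
    (h23 : ρ 2 < ρ 3) (h45 : ρ 4 < ρ 5) (h56 : ρ 5 < ρ 6) (h67 : ρ 6 < ρ 7) :
    uEq z (ρ 0) (ρ 1) (ρ 2) (ρ 3) (ρ 4) (ρ 5) (ρ 6) (ρ 7) =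
      pluckerU (Matrix.of (xc z)) (Matrix.of (yc z)) ρ := by
  have hρ : ![ρ 0, ρ 1, ρ 2, ρ 3, ρ 4, ρ 5, ρ 6, ρ 7] = ρ := by
    ext i
    fin_cases i <;> rfl
  have h := sign_sorted (ρ 0) (ρ 1) h01 (ρ 2) h12 (ρ 3) h23 (ρ 4) (by simp) (ρ 5)
    ⟨h45, by simp⟩ (ρ 6) ⟨h56, by simp⟩ (ρ 7) ⟨h67, by simp⟩
  rw [hρ] at h
  have hs : (Perm.sign ρ : ℤ) = (-1) ^ ((ρ 0 : ℕ) + ρ 1 + ρ 2 + ρ 3) := by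
    rw [← h, Perm.sign_eq_prod_prod_Iio]
    push_cast
    simp [apply_ite]
  rw [pluckerU, hs]
  push_cast
  rfl

theorem exists_blockPerm_sorted (σ : Perm (Fin 8)) : ∃ τ₁ τ₂ : Perm (Fin 4),
    StrictMono ((σ * blockPerm τ₁ τ₂) ∘ Fin.castAdd (n := 4) 4) ∧
      StrictMono ((σ * blockPerm τ₁ τ₂) ∘ Fin.natAdd (m := 4) 4) := by
  have hl : Function.Injective (σ ∘ Fin.castAdd (n := 4) 4) :=
    σ.injective.comp (Fin.castAdd_injective 4 4)
  have hr : Function.Injective (σ ∘ Fin.natAdd (m := 4) 4) :=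
    σ.injective.comp (Fin.natAdd_injective 4 4)
  refine ⟨Tuple.sort (σ ∘ Fin.castAdd (n := 4) 4), Tuple.sort (σ ∘ Fin.natAdd (m := 4) 4), ?_, ?_⟩
  · convert (Tuple.monotone_sort (σ ∘ Fin.castAdd (n := 4) 4)).strictMono_of_injective
      (hl.comp (Equiv.injective _)) using 1
    ext i
    simp only [Function.comp_apply, Perm.mul_apply, blockPerm_castAdd]
  · convert (Tuple.monotone_sort (σ ∘ Fin.natAdd (m := 4) 4)).strictMono_of_injective
      (hr.comp (Equiv.injective _)) using 1
    ext i
    simp only [Function.comp_apply, Perm.mul_apply, blockPerm_natAdd]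

theorem vDiag_eq_zero [CharZero K] (z : I56 → K) {c : K}
    (h : ∀ i, (Matrix.of (xc z) * Matrix.of (yc z)) i i = c) (i : Fin 8) : vDiag z i = 0 := by
  have hdiag (i : Fin 8) : ∑ j, xc z i j * yc z i j = -c := by
    rw [← h i, Matrix.mul_apply, ← Finset.sum_neg_distrib]
    refine Finset.sum_congr rfl fun j _ => ?_
    rw [Matrix.of_apply, Matrix.of_apply, yc_skew z j i, mul_neg, neg_neg]
  have hsymm (i j : Fin 8) : xc z i j * yc z i j = xc z j i * yc z j i := by
    rw [xc_skew z i j, yc_skew z i j, neg_mul_neg]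
  have hself (i : Fin 8) : xc z i i * yc z i i = 0 := by simp [xc]
  rw [vDiag, Finset.sum_sdiff_eq_sub (Finset.subset_univ _), Finset.sum_singleton, hself, hdiag,
    Finset.sum_filter, Fintype.sum_prod_type]
  dsimp only
  generalize hw : (fun i j : Fin 8 => xc z i j * yc z i j) = w
  have hw' (i j : Fin 8) : xc z i j * yc z i j = w i j := by rw [← hw]
  simp only [hw'] at hdiag hsymm hself ⊢
  set S := ∑ a, ∑ b, if a < b ∧ a ≠ i ∧ b ≠ i then w a b else 0 with hS
  have hS' : S = ∑ a, ∑ b, if b < a ∧ a ≠ i ∧ b ≠ i then w a b else 0 := by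
    rw [hS, Finset.sum_comm]
    refine Finset.sum_congr rfl fun a _ => Finset.sum_congr rfl fun b _ => ?_
    simp only [hsymm b a, and_comm (a := b ≠ i)]
  have h2 : S + S = ∑ a, if a = i then 0 else (-c - w i a) := by
    nth_rw 2 [hS']
    rw [hS, ← Finset.sum_add_distrib]
    refine Finset.sum_congr rfl fun a _ => ?_
    rw [← Finset.sum_add_distrib]
    split_ifs with ha
    · simp [ha]
    · rw [← hdiag a, hsymm i a, ← Finset.sum_singleton (fun b => w a b) i,
        ← Finset.sum_sdiff_eq_sub (Finset.subset_univ _), Finset.sdiff_singleton_eq_erase,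
        ← Finset.filter_ne', Finset.sum_filter]
      refine Finset.sum_congr rfl fun b _ => ?_
      rcases lt_trichotomy a b with hab | rfl | hab
      · simp [ha, hab, hab.not_gt]
      · simp [hself]
      · simp [ha, hab, hab.not_gt]
  have h6 : S + S = -(6 * c) := by
    rw [h2, Finset.sum_ite, Finset.sum_const_zero, zero_add, Finset.filter_not,
      Finset.sum_sdiff_eq_sub (Finset.filter_subset _ _), Finset.sum_sub_distrib, hdiag,
      Finset.filter_eq' Finset.univ i, if_pos (Finset.mem_univ i), Finset.sum_singleton, hself]
    simp
    ring
  linear_combination h6 / 8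

theorem mul_block_eq_zero [CharZero K] {X Y : Matrix (Fin 8) (Fin 8) K}
    (hX : ∀ i j, X i j = -X j i) (hY : ∀ i j, Y i j = -Y j i)
    (hη : ∀ i, i ≠ 7 → X i 7 ≠ 0) (hrow : ∀ i, i ≠ 7 → (X * Y) 7 i = 0)
    (hu : ∀ σ : Perm (Fin 8), σ 3 = 7 → pluckerU X Y σ = 0)
    (h0 : ∀ i, i ≠ 0 → i ≠ 7 → (X * Y) 0 i = 0) (h10 : (X * Y) 1 0 = 0)
    (i j : Fin 8) (hij : i ≠ j) (hi : i ≠ 7) (hj : j ≠ 7) : (X * Y) i j = 0 := by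
  have key {p : Fin 8} (hp : p ≠ 7) (hpi : p ≠ i) (hpj : p ≠ j) (h : (X * Y) p j = 0) :
      (X * Y) i j = 0 := by
    have e := mul_apply_exchange hX hY hrow hu hpi hpj hij hp hi hj
    rw [h, mul_zero] at e
    exact (mul_eq_zero_iff_left (hη p hp)).mp e
  by_cases hi0 : i = 0
  · subst hi0
    exact h0 j hij.symm hj
  by_cases hj0 : j = 0
  · subst hj0
    by_cases hi1 : i = 1
    · rwa [hi1]
    · exact key (by decide) (Ne.symm hi1) (by decide) h10
  · exact key (by decide) (Ne.symm hi0) (Ne.symm hj0) (h0 j hj0 hj)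

theorem statement6 [IsAlgClosed K] [CharZero K] (z : I56 → K)
    (hη : ∀ i : Fin 8, i < 7 → xc z i 7 ≠ 0)
    -- `v^8_i = 0` for `i = 2,…,7`:
    (h1 : ∀ i : Fin 8, 0 < i → i < 7 → vEq z 7 i = 0)
    -- `u^{1jk8} = 0` for `2 ≤ j < k ≤ 7` (complement `a<b<c<d`):
    (h2 : ∀ j k a b c d : Fin 8, 0 < j → j < k → k < 7 → a < b → b < c → c < d →
      ({0, j, k, 7, a, b, c, d} : Finset (Fin 8)) = Finset.univ →
      uEq z 0 j k 7 a b c d = 0)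
    -- `v^1_i = 0` for `i = 2,…,7`:
    (h3 : ∀ i : Fin 8, 0 < i → i < 7 → vEq z 0 i = 0)
    -- `v^2_1 = 0`:
    (h4 : vEq z 1 0 = 0) :
    H7mem z := by
  have hX (i j : Fin 8) : Matrix.of (xc z) i j = -Matrix.of (xc z) j i := xc_skew z i j
  have hY (i j : Fin 8) : Matrix.of (yc z) i j = -Matrix.of (yc z) j i := yc_skew z i j
  have hη' (i : Fin 8) (hi : i ≠ 7) : Matrix.of (xc z) i 7 ≠ 0 := hη i (by omega)
  have hrow := mul_apply_of_first_column hX hY (hη' 0 (by decide)) fun i h0 h7 => by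
    rw [← vEq_eq_mul z h7.symm]
    exact h1 i (by omega) (by omega)
  have hsorted (σ : Perm (Fin 8)) (hσ0 : σ 0 = 0) (hσ3 : σ 3 = 7) :
      pluckerU (Matrix.of (xc z)) (Matrix.of (yc z)) σ = 0 := by
    obtain ⟨τ₁, τ₂, hl, hr⟩ := exists_blockPerm_sorted σ
    rw [← pluckerU_mul_blockPerm_eq_zero hX hY τ₁ τ₂]
    have hmem (i : Fin 4) :
        (σ * blockPerm τ₁ τ₂) (Fin.castAdd 4 (τ₁.symm i)) = σ (Fin.castAdd 4 i) := by
      rw [Perm.mul_apply, blockPerm_castAdd, Equiv.apply_symm_apply]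
    have hmem0 := (hmem 0).trans hσ0
    have hmem3 := (hmem 3).trans hσ3
    generalize σ * blockPerm τ₁ τ₂ = ρ at *
    have hρ0 : ρ 0 = 0 := Fin.le_zero_iff.mp ((hl.monotone (Fin.zero_le _)).trans_eq hmem0)
    have hρ3 : ρ 3 = 7 := Fin.last_le_iff.mp (hmem3.symm.trans_le (hl.monotone (Fin.le_last _)))
    have h01 : ρ 0 < ρ 1 := hl (show (0 : Fin 4) < 1 by decide)
    have h12 : ρ 1 < ρ 2 := hl (show (1 : Fin 4) < 2 by decide)
    have h23 : ρ 2 < ρ 3 := hl (show (2 : Fin 4) < 3 by decide)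
    have h45 : ρ 4 < ρ 5 := hr (show (0 : Fin 4) < 1 by decide)
    have h56 : ρ 5 < ρ 6 := hr (show (1 : Fin 4) < 2 by decide)
    have h67 : ρ 6 < ρ 7 := hr (show (2 : Fin 4) < 3 by decide)
    have huniv : ({ρ 0, ρ 1, ρ 2, ρ 3, ρ 4, ρ 5, ρ 6, ρ 7} : Finset (Fin 8)) = Finset.univ := by
      refine Finset.eq_univ_iff_forall.mpr fun m => ?_
      obtain ⟨i, rfl⟩ := ρ.surjective m
      fin_cases i <;> simp
    rw [← uEq_eq_pluckerU z ρ h01 h12 h23 h45 h56 h67]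
    rw [hρ0, hρ3] at *
    exact h2 _ _ _ _ _ _ h01 h12 h23 h45 h56 h67 huniv
  have hu := pluckerU_eq_zero_of_seven_mem hX hY (hη' 0 (by decide)) hrow hsorted
  have hscalar := mul_eq_scalar_of_block hX hY hη' hrow <|
    mul_block_eq_zero hX hY hη' hrow (fun σ hσ => hu σ ⟨3, hσ⟩)
      (fun i h0 h7 => by
        rw [← vEq_eq_mul z h0.symm]
        exact h3 i (by omega) (by omega))
      (by rwa [← vEq_eq_mul z (by decide)])
  have hv (i j : Fin 8) (hij : i ≠ j) : (Matrix.of (xc z) * Matrix.of (yc z)) i j = 0 := by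
    rw [hscalar, if_neg hij]
  refine ⟨?_, fun i j hij => by rw [vEq_eq_mul z hij, hv i j hij],
    vDiag_eq_zero z fun i => by rw [hscalar, if_pos rfl]⟩
  intro i j k l a b c d hij hjk hkl hab hbc hcd huniv
  have hinj : Function.Injective ![i, j, k, l, a, b, c, d] := by
    rw [Finite.injective_iff_surjective]
    intro m
    have hm : m ∈ ({i, j, k, l, a, b, c, d} : Finset (Fin 8)) := huniv ▸ Finset.mem_univ m
    simpa [Fin.exists_fin_succ, eq_comm] using hm
  exact (uEq_eq_pluckerU z (Equiv.ofBijective _ (Finite.injective_iff_bijective.mp hinj))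
    hij hjk hkl hab hbc hcd).trans (pluckerU_eq_zero hX hY hη' hv hsorted _)
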